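/- arXiv:1504.04736 — 4 statements merged into one kernel-verified Lean document; each statement's English description precedes it below -/
import Mathlib

section
/- Let a ∈ ℝ and b ∈ ℝ with b ≠ −1, and let α, β ∈ ℝ with α ≠ 0, β ≠ 0 and α + β = 1. Let z, g, f ∈ ℂ satisfy the two equations α·(z·g − 1) = f·g − 1 and α·β·((1 + a·z + b·z²)·g − a − z·b)/(b + 1) + α²·(z²·g − z) = −f + f²·g. Then g satisfies the quadratic equation (1 + a·z + b·z²)·g² − (z + a + 2·b·z)·g + (1 + b) = 0. -/
/-- Algebraic core of the free/monotone Laha–Lukacs theorems: the two equations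
obtained from the conditional moment assumptions force the quadratic equation
for `g = G_{X+Y}(z)`. -/
theorem laha_lukacs_quadratic
    (a b α β : ℝ) (hb : b ≠ -1) (hα : α ≠ 0) (hβ : β ≠ 0) (hαβ : α + β = 1)
    (z g f : ℂ)
    (h1 : (α : ℂ) * (z * g - 1) = f * g - 1)
    (h2 : (α : ℂ) * β * ((1 + a * z + b * z ^ 2) * g - a - z * b) / (b + 1)
            + (α : ℂ) ^ 2 * (z ^ 2 * g - z) = -f + f ^ 2 * g) :
    (1 + (a : ℂ) * z + b * z ^ 2) * g ^ 2 - (z + a + 2 * b * z) * g + (1 + b) = 0 := by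
  have hb' : (b : ℂ) + 1 ≠ 0 := by
    intro h
    apply hb
    have : b + 1 = 0 := by exact_mod_cast h
    linarith
  have hα' : (α : ℂ) ≠ 0 := by exact_mod_cast hα
  have hβ' : (β : ℂ) ≠ 0 := by exact_mod_cast hβ
  have hs : (β : ℂ) = 1 - α := by
    have : β = 1 - α := by linarith
    rw [this]; push_cast; ring
  have h3 : (α : ℂ) * β * ((1 + a * z + b * z ^ 2) * g - a - z * b)
      + (α : ℂ) ^ 2 * (z ^ 2 * g - z) * (b + 1) = (-f + f ^ 2 * g) * (b + 1) := by
    rw [← h2, add_mul (_ / _), div_mul_cancel₀ _ hb']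
  have h4 : (α : ℂ) * β *
      ((1 + (a : ℂ) * z + b * z ^ 2) * g ^ 2 - (z + a + 2 * b * z) * g + (1 + b)) = 0 := by
    rw [hs] at h3 ⊢
    linear_combination g * h3 - ((b : ℂ) + 1) * (f * g + α * z * g - α) * h1
  exact (mul_eq_zero.mp h4).resolve_left (mul_ne_zero hα' hβ')
end

section
/- Let c, d, α ∈ ℝ and z ∈ ℂ with z ≠ −1 and u := (c − 1)·d·α + z·(1 − c·d) ≠ 0. Define χ = (z/(z + 1))·( 1 + (1 − d)/u ). Then z·(z − d·(1 + α) + 1)·(χ − 1) = d·(z − α)·( c·z·(χ − 1) + (c − 1)·χ ). -/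
/-- The explicit formula for `χ_{Y^{1/2}XY^{1/2}}` solves the functional equation
(with denominators cleared). -/
theorem chi_VUV_functional_equation
    (c d α : ℝ) (z : ℂ) (hz : z ≠ -1)
    (u : ℂ) (hu : u = ((c : ℂ) - 1) * d * α + z * (1 - c * d)) (hu0 : u ≠ 0)
    (χ : ℂ) (hχ : χ = (z / (z + 1)) * (1 + (1 - (d : ℂ)) / u)) :
    z * (z - (d : ℂ) * (1 + α) + 1) * (χ - 1)
      = (d : ℂ) * (z - α) * ((c : ℂ) * z * (χ - 1) + ((c : ℂ) - 1) * χ) := by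
  have hz1 : z + 1 ≠ 0 := fun h => hz (eq_neg_of_add_eq_zero_left h)
  have key : χ * ((z + 1) * u) = z * (u + 1 - d) := by
    rw [hχ]
    field_simp
    ring
  rw [hu] at key
  linear_combination key
end

section
/- Let c, d, α ∈ ℝ and z ∈ ℂ with z ≠ −1 and v := (c − 1)·(d·(1 + α) − 1) + z·(1 − c·d) ≠ 0. Define χ = (z/(z + 1))·( 1 + c·(1 − d)/v ). Then (z − d·(1 + α) + 1)·( z·(χ − 1) − (c − 1)·χ ) = c·d·z·(z − α)·(χ − 1). -/
/-- The explicit formula for `χ_Y` solves the functional equation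
(with denominators cleared). -/
theorem chi_Y_functional_equation
    (c d α : ℝ) (z : ℂ) (hz : z ≠ -1)
    (v : ℂ) (hv : v = ((c : ℂ) - 1) * ((d : ℂ) * (1 + α) - 1) + z * (1 - c * d))
    (hv0 : v ≠ 0)
    (χ : ℂ) (hχ : χ = (z / (z + 1)) * (1 + (c : ℂ) * (1 - d) / v)) :
    (z - (d : ℂ) * (1 + α) + 1) * (z * (χ - 1) - ((c : ℂ) - 1) * χ)
      = (c : ℂ) * d * z * (z - α) * (χ - 1) := by
  have hz1 : z + 1 ≠ 0 := fun h => hz (eq_neg_of_add_eq_zero_left h)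
  have h : (z + 1) * v * χ = z * (v + (c : ℂ) * (1 - d)) := by
    rw [hχ]
    clear hv hχ
    field_simp
  linear_combination h - (χ * (z + 1) - z) * hv
end

section
/- Let A be a unital associative algebra over ℂ, let φ : A → ℂ be a linear functional with φ(1) = 1 which is tracial, i.e. φ(S·T) = φ(T·S) for all S, T ∈ A, and let B, B' be subalgebras of A such that φ(X·Y·Z) = φ(X)·φ(Y)·φ(Z) for all X, Z ∈ B, Y ∈ B', and φ(W·Y) = φ(W)·φ(Y) for all W ∈ B, Y ∈ B'. Then for all X₁, X₂ ∈ B and Y ∈ B' one has φ(X₁)·φ(X₂)·φ(Y) = φ(X₂·X₁)·φ(Y). -/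
/-- Remark on monotone independence, second part: if `φ` is tracial and the two
factorization properties hold, then `φ(X₁)φ(X₂)φ(Y) = φ(X₂X₁)φ(Y)`. -/
theorem monotone_tracial_multiplicative
    {A : Type*} [Ring A] [Algebra ℂ A]
    (φ : A →ₗ[ℂ] ℂ) (hφ1 : φ 1 = 1)
    (htr : ∀ S T : A, φ (S * T) = φ (T * S))
    (B B' : NonUnitalSubalgebra ℂ A)
    (hfact : ∀ X ∈ B, ∀ Z ∈ B, ∀ Y ∈ B', φ (X * Y * Z) = φ X * φ Y * φ Z)
    (hfact2 : ∀ W ∈ B, ∀ Y ∈ B', φ (W * Y) = φ W * φ Y) :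
    ∀ X₁ ∈ B, ∀ X₂ ∈ B, ∀ Y ∈ B',
      φ X₁ * φ X₂ * φ Y = φ (X₂ * X₁) * φ Y := by
  intro X₁ h₁ X₂ h₂ Y hY
  have h := hfact X₁ h₁ X₂ h₂ Y hY
  rw [htr, ← mul_assoc, hfact2 _ (B.mul_mem h₂ h₁) Y hY] at h
  rw [h]
  ring
end
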